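/- Fix n ≥ 2 and lengths l₁,…,l_{n−1} > 0, and consider the map S = (S₁,…,Sₙ), S_i = L_{h₁}^{i−1} y₁, defined on U = { y ∈ ℝⁿ : cos y_k ≠ 0 for k = 2,…,n }. For each μ = (μ₁,…,μ_{n−1}) ∈ {0,1}^{n−1}, let O_μ = { y ∈ ℝⁿ : |y_i − μ_{i−1}π| < π/2 for i = 2,…,n }. Then S restricted to O_μ is a bijection from O_μ onto ℝⁿ. -/

import Mathlib

open Set

/-- The `k`-th coordinate (1-based, as in the paper) of `y ∈ ℝⁿ`. -/
noncomputable def coord {n : ℕ} (y : EuclideanSpace ℝ (Fin n)) (k : ℕ) : ℝ :=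
  if h : k - 1 < n then y ⟨k - 1, h⟩ else 0

/-- `σ_i(y₂, …, y_i) = ∏_{k=2}^i sec y_k` (so `σ₁ ≡ 1`). -/
noncomputable def sigmaFun {n : ℕ} (i : ℕ) (y : EuclideanSpace ℝ (Fin n)) : ℝ :=
  ∏ k ∈ Finset.Icc 2 i, (Real.cos (coord y k))⁻¹

/-- `η₁(y₂) = l₁⁻¹ tan y₂` and
`η_i(y₂, …, y_{i+1}) = (l_i⁻¹ tan y_{i+1} − l_{i-1}⁻¹ sin y_i)·σ_i` for `i ≥ 2`. -/
noncomputable def etaFun {n : ℕ} (l : ℕ → ℝ) (i : ℕ)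
    (y : EuclideanSpace ℝ (Fin n)) : ℝ :=
  if i = 1 then (l 1)⁻¹ * Real.tan (coord y 2)
  else ((l i)⁻¹ * Real.tan (coord y (i + 1)) - (l (i - 1))⁻¹ * Real.sin (coord y i)) *
    sigmaFun i y

/-- Lie derivative of a scalar function `φ` along a vector field `h` on `ℝⁿ`. -/
noncomputable def lieDeriv {n : ℕ} (h : EuclideanSpace ℝ (Fin n) → EuclideanSpace ℝ (Fin n))
    (φ : EuclideanSpace ℝ (Fin n) → ℝ) : EuclideanSpace ℝ (Fin n) → ℝ :=
  fun y => fderiv ℝ φ y (h y)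

/-- Repeated Lie derivatives. -/
noncomputable def lieIter {n : ℕ} (h : EuclideanSpace ℝ (Fin n) → EuclideanSpace ℝ (Fin n))
    (φ : EuclideanSpace ℝ (Fin n) → ℝ) : ℕ → EuclideanSpace ℝ (Fin n) → ℝ
  | 0 => φ
  | (i + 1) => lieDeriv h (lieIter h φ i)


open scoped ContDiff

/-- The projection of `ℝⁿ` that keeps the first `i` coordinates and sets the others to zero. -/
noncomputable def truncate {n : ℕ} (i : ℕ) :
    EuclideanSpace ℝ (Fin n) →L[ℝ] EuclideanSpace ℝ (Fin n) :=
  LinearMap.toContinuousLinearMap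
    { toFun := fun y => WithLp.toLp 2 fun j => if (j : ℕ) < i then y j else 0
      map_add' := fun x y => by
        ext j
        by_cases hj : (j : ℕ) < i <;> simp [hj]
      map_smul' := fun c y => by
        ext j
        by_cases hj : (j : ℕ) < i <;> simp [hj] }

/-- The open set on which `cos y_k ≠ 0` for all `k ≥ 2`. -/
def regularSet (n : ℕ) : Set (EuclideanSpace ℝ (Fin n)) :=
  { y | ∀ k ∈ Finset.Icc 2 n, Real.cos (coord y k) ≠ 0 }

section

variable {n : ℕ}

theorem truncate_apply (i : ℕ) (y : EuclideanSpace ℝ (Fin n)) (j : Fin n) :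
    truncate i y j = if (j : ℕ) < i then y j else 0 := rfl

theorem coord_succ (y : EuclideanSpace ℝ (Fin n)) (j : Fin n) :
    coord y ((j : ℕ) + 1) = y j := by
  simp [coord]

theorem coord_truncate (i k : ℕ) (y : EuclideanSpace ℝ (Fin n)) :
    coord (truncate i y) k = if k - 1 < i then coord y k else 0 := by
  unfold coord
  split_ifs <;> simp_all [truncate_apply]

theorem truncate_truncate {i j : ℕ} (hij : i ≤ j) (y : EuclideanSpace ℝ (Fin n)) :
    truncate i (truncate j y) = truncate i y := by
  ext k
  simp only [truncate_apply]
  split_ifs <;> first | rfl | omega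

theorem contDiff_coord (k : ℕ) :
    ContDiff ℝ ∞ fun y : EuclideanSpace ℝ (Fin n) => coord y k := by
  unfold coord
  split_ifs <;> fun_prop

theorem cos_coord_ne_zero {y : EuclideanSpace ℝ (Fin n)} (hy : y ∈ regularSet n) {k : ℕ}
    (hk : 2 ≤ k) : Real.cos (coord y k) ≠ 0 := by
  by_cases hkn : k ≤ n
  · exact hy k (Finset.mem_Icc.2 ⟨hk, hkn⟩)
  · simp [coord, show ¬ k - 1 < n by omega]

theorem isOpen_regularSet : IsOpen (regularSet n) := by
  have : regularSet n = ⋂ k ∈ Finset.Icc 2 n, { y | Real.cos (coord y k) ≠ 0 } := by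
    ext y
    simp [regularSet]
  rw [this]
  exact isOpen_biInter_finset fun k _ =>
    isOpen_ne_fun (Real.continuous_cos.comp (contDiff_coord k).continuous) continuous_const

theorem truncate_mem_regularSet (i : ℕ) {y : EuclideanSpace ℝ (Fin n)} (hy : y ∈ regularSet n) :
    truncate i y ∈ regularSet n := by
  intro k hk
  rw [coord_truncate]
  split_ifs
  · exact hy k hk
  · simp

theorem contDiffOn_tan_coord {k : ℕ} (hk : 2 ≤ k) :
    ContDiffOn ℝ ∞ (fun y : EuclideanSpace ℝ (Fin n) => Real.tan (coord y k)) (regularSet n) := by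
  simp only [Real.tan_eq_sin_div_cos]
  exact (contDiff_coord k).sin.contDiffOn.div (contDiff_coord k).cos.contDiffOn
    fun y hy => cos_coord_ne_zero hy hk

theorem contDiffOn_sigmaFun (i : ℕ) :
    ContDiffOn ℝ ∞ (fun y : EuclideanSpace ℝ (Fin n) => sigmaFun i y) (regularSet n) :=
  contDiffOn_prod fun _ hk => (contDiff_coord _).cos.contDiffOn.inv
    fun _ hy => cos_coord_ne_zero hy (Finset.mem_Icc.1 hk).1

theorem sigmaFun_ne_zero (i : ℕ) {y : EuclideanSpace ℝ (Fin n)} (hy : y ∈ regularSet n) :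
    sigmaFun i y ≠ 0 :=
  Finset.prod_ne_zero_iff.2 fun _ hk =>
    inv_ne_zero (cos_coord_ne_zero hy (Finset.mem_Icc.1 hk).1)

theorem sigmaFun_truncate {i j : ℕ} (hij : i ≤ j) (y : EuclideanSpace ℝ (Fin n)) :
    sigmaFun i (truncate j y) = sigmaFun i y := by
  refine Finset.prod_congr rfl fun k hk => ?_
  rw [Finset.mem_Icc] at hk
  rw [coord_truncate, if_pos (by omega)]

theorem contDiffOn_etaFun (l : ℕ → ℝ) {i : ℕ} (hi : 1 ≤ i) :
    ContDiffOn ℝ ∞ (fun y : EuclideanSpace ℝ (Fin n) => etaFun l i y) (regularSet n) := by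
  unfold etaFun
  split_ifs
  · exact contDiffOn_const.mul (contDiffOn_tan_coord le_rfl)
  · exact ((contDiffOn_const.mul (contDiffOn_tan_coord (by omega))).sub
      (contDiffOn_const.mul (contDiff_coord i).sin.contDiffOn)).mul (contDiffOn_sigmaFun i)

theorem etaFun_truncate (l : ℕ → ℝ) {i j : ℕ} (hi : 1 ≤ i) (hij : i < j)
    (y : EuclideanSpace ℝ (Fin n)) : etaFun l i (truncate j y) = etaFun l i y := by
  unfold etaFun
  rw [sigmaFun_truncate hij.le, coord_truncate, coord_truncate, coord_truncate,
    if_pos (show 2 - 1 < j by omega), if_pos (show i + 1 - 1 < j by omega),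
    if_pos (show i - 1 < j by omega)]

/-- A function on `regularSet n` that is smooth and depends on the first `i` coordinates only. -/
structure SmoothInFirst (i : ℕ) (φ : EuclideanSpace ℝ (Fin n) → ℝ) : Prop where
  contDiffOn : ContDiffOn ℝ ∞ φ (regularSet n)
  apply_truncate : ∀ y ∈ regularSet n, φ (truncate i y) = φ y

namespace SmoothInFirst

variable {i : ℕ} {φ ψ : EuclideanSpace ℝ (Fin n) → ℝ}

theorem mul (hφ : SmoothInFirst i φ) (hψ : SmoothInFirst i ψ) :
    SmoothInFirst i fun y => φ y * ψ y :=
  ⟨hφ.1.mul hψ.1, fun y hy => by rw [hφ.2 y hy, hψ.2 y hy]⟩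

theorem add (hφ : SmoothInFirst i φ) (hψ : SmoothInFirst i ψ) :
    SmoothInFirst i fun y => φ y + ψ y :=
  ⟨hφ.1.add hψ.1, fun y hy => by rw [hφ.2 y hy, hψ.2 y hy]⟩

theorem sub (hφ : SmoothInFirst i φ) (hψ : SmoothInFirst i ψ) :
    SmoothInFirst i fun y => φ y - ψ y :=
  ⟨hφ.1.sub hψ.1, fun y hy => by rw [hφ.2 y hy, hψ.2 y hy]⟩

theorem const (c : ℝ) : SmoothInFirst (n := n) i fun _ => c :=
  ⟨contDiffOn_const, fun _ _ => rfl⟩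

theorem mono (hφ : SmoothInFirst i φ) {j : ℕ} (hij : i ≤ j) : SmoothInFirst j φ :=
  ⟨hφ.1, fun y hy => by
    rw [← hφ.2 _ (truncate_mem_regularSet j hy), truncate_truncate hij, hφ.2 y hy]⟩

theorem differentiableAt (hφ : SmoothInFirst i φ) {y : EuclideanSpace ℝ (Fin n)}
    (hy : y ∈ regularSet n) : DifferentiableAt ℝ φ y :=
  (hφ.1.contDiffAt (isOpen_regularSet.mem_nhds hy)).differentiableAt (by simp)

theorem fderiv_truncate (hφ : SmoothInFirst i φ) {y : EuclideanSpace ℝ (Fin n)}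
    (hy : y ∈ regularSet n) (v : EuclideanSpace ℝ (Fin n)) :
    fderiv ℝ φ (truncate i y) (truncate i v) = fderiv ℝ φ y v := by
  have hcomp : (φ ∘ truncate i) =ᶠ[nhds y] φ :=
    Filter.eventually_of_mem (isOpen_regularSet.mem_nhds hy) hφ.2
  rw [← hcomp.fderiv_eq, fderiv_comp y
    (hφ.differentiableAt (truncate_mem_regularSet i hy)) (truncate i).differentiableAt,
    ContinuousLinearMap.fderiv]
  rfl

theorem congr_truncate (hφ : SmoothInFirst i φ) {y y' : EuclideanSpace ℝ (Fin n)}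
    (hy : y ∈ regularSet n) (hy' : y' ∈ regularSet n) (h : ∀ j : Fin n, (j : ℕ) < i → y j = y' j) :
    φ y = φ y' := by
  rw [← hφ.2 y hy, ← hφ.2 y' hy']
  congr 1
  ext j
  simp only [truncate_apply]
  split_ifs with hj
  · exact h j hj
  · rfl

end SmoothInFirst

theorem smoothInFirst_sigmaFun (i : ℕ) : SmoothInFirst (n := n) i (sigmaFun i) :=
  ⟨contDiffOn_sigmaFun i, fun y _ => sigmaFun_truncate le_rfl y⟩

theorem smoothInFirst_sin_coord {i : ℕ} (hi : 1 ≤ i) :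
    SmoothInFirst (n := n) i fun y => Real.sin (coord y i) :=
  ⟨(contDiff_coord i).sin.contDiffOn, fun y _ => by rw [coord_truncate, if_pos (by omega)]⟩

theorem smoothInFirst_tan_coord {i : ℕ} (hi : 2 ≤ i) :
    SmoothInFirst (n := n) i fun y => Real.tan (coord y i) :=
  ⟨contDiffOn_tan_coord hi, fun y _ => by rw [coord_truncate, if_pos (by omega)]⟩

theorem smoothInFirst_inv_cos_coord_sq {i : ℕ} (hi : 2 ≤ i) :
    SmoothInFirst (n := n) i fun y => 1 / Real.cos (coord y i) ^ 2 :=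
  ⟨contDiffOn_const.div ((contDiff_coord i).cos.pow 2).contDiffOn
      fun _ hy => pow_ne_zero 2 (cos_coord_ne_zero hy hi),
    fun y _ => by rw [coord_truncate, if_pos (by omega)]⟩

theorem hasFDerivAt_coord_succ (y : EuclideanSpace ℝ (Fin n)) (j : Fin n) :
    HasFDerivAt (fun y : EuclideanSpace ℝ (Fin n) => coord y ((j : ℕ) + 1))
      (EuclideanSpace.proj j : EuclideanSpace ℝ (Fin n) →L[ℝ] ℝ) y := by
  simp only [coord_succ]
  exact (EuclideanSpace.proj j : EuclideanSpace ℝ (Fin n) →L[ℝ] ℝ).hasFDerivAt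

variable {l : ℕ → ℝ} {h : EuclideanSpace ℝ (Fin n) → EuclideanSpace ℝ (Fin n)}

theorem SmoothInFirst.lieDeriv
    (hh : ∀ y (j : Fin n), h y j = if (j : ℕ) < n - 1 then etaFun l ((j : ℕ) + 1) y else 0)
    {i : ℕ} {φ : EuclideanSpace ℝ (Fin n) → ℝ} (hφ : SmoothInFirst i φ) :
    SmoothInFirst (i + 1) (lieDeriv h φ) := by
  have hsmooth : ContDiffOn ℝ ∞ h (regularSet n) := by
    rw [contDiffOn_euclidean]
    intro j
    simp only [hh]
    split_ifs
    · exact contDiffOn_etaFun l (by omega)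
    · exact contDiffOn_const
  refine ⟨(hφ.1.fderiv_of_isOpen isOpen_regularSet (by simp)).clm_apply hsmooth,
    fun y hy => ?_⟩
  have hv : truncate i (h (truncate (i + 1) y)) = truncate i (h y) := by
    ext j
    simp only [truncate_apply, hh]
    split_ifs with hj
    · exact etaFun_truncate l (by omega) (by omega) y
    · rfl
    · rfl
  unfold _root_.lieDeriv
  rw [← hφ.fderiv_truncate hy, ← hφ.fderiv_truncate (truncate_mem_regularSet _ hy),
    truncate_truncate (Nat.le_succ i), hv]

/-- The triangular structure of the iterated Lie derivatives of the first coordinate. -/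
theorem exists_lieIter_eq (hl : ∀ i, 1 ≤ i → i ≤ n - 1 → 0 < l i)
    (hh : ∀ y (j : Fin n), h y j = if (j : ℕ) < n - 1 then etaFun l ((j : ℕ) + 1) y else 0)
    {φ : EuclideanSpace ℝ (Fin n) → ℝ} (hφ : ∀ y, φ y = coord y 1)
    {i : ℕ} (hi : 1 ≤ i) (hin : i < n) :
    ∃ θ ξ : EuclideanSpace ℝ (Fin n) → ℝ, SmoothInFirst i θ ∧ SmoothInFirst i ξ ∧
      (∀ y ∈ regularSet n, θ y ≠ 0) ∧
      ∀ y ∈ regularSet n, lieIter h φ i y = θ y * Real.tan (coord y (i + 1)) + ξ y := by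
  induction i, hi using Nat.le_induction with
  | base =>
    refine ⟨fun _ => (l 1)⁻¹, fun _ => 0, .const _, .const _,
      fun _ _ => inv_ne_zero (hl 1 le_rfl (by omega)).ne', fun y _ => ?_⟩
    have h0 := hasFDerivAt_coord_succ y ⟨0, by omega⟩
    have : φ = fun y => coord y 1 := funext hφ
    subst this
    change fderiv ℝ (fun y => coord y ((0 : ℕ) + 1)) y (h y) = _
    rw [h0.fderiv]
    simp [hh, etaFun, show 0 < n - 1 by omega]
  | succ i hi ih =>
    obtain ⟨θ, ξ, hθ, hξ, hθ0, heq⟩ := ih (by omega)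
    have hcos := smoothInFirst_inv_cos_coord_sq (n := n) (i := i + 1) (by omega)
    have hsig := smoothInFirst_sigmaFun (n := n) (i + 1)
    have hθ' := (hθ.mono (Nat.le_succ i)).mul (hcos.mul hsig)
    refine ⟨_, _, hθ'.mul (.const (l (i + 1))⁻¹),
      (((hθ.lieDeriv hh).mul (smoothInFirst_tan_coord (by omega))).add (hξ.lieDeriv hh)).sub
        (hθ'.mul ((SmoothInFirst.const (l i)⁻¹).mul (smoothInFirst_sin_coord (by omega)))),
      fun y hy => ?_, fun y hy => ?_⟩
    · exact mul_ne_zero (mul_ne_zero (hθ0 y hy) (mul_ne_zero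
        (one_div_ne_zero (pow_ne_zero 2 (cos_coord_ne_zero hy (by omega))))
        (sigmaFun_ne_zero _ hy))) (inv_ne_zero (hl _ (by omega) (by omega)).ne')
    · have hev : lieIter h φ i =ᶠ[nhds y]
          fun y => θ y * Real.tan (coord y (i + 1)) + ξ y :=
        Filter.eventually_of_mem (isOpen_regularSet.mem_nhds hy) heq
      have htan := (Real.hasDerivAt_tan
        (cos_coord_ne_zero hy (k := i + 1) (by omega))).comp_hasFDerivAt y
          (hasFDerivAt_coord_succ y ⟨i, by omega⟩)
      have hd := ((hθ.differentiableAt hy).hasFDerivAt.mul htan).add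
        (hξ.differentiableAt hy).hasFDerivAt
      change fderiv ℝ (lieIter h φ i) y (h y) = _
      rw [(hd.congr_of_eventuallyEq hev).fderiv]
      simp [hh, etaFun, lieDeriv, show i < n - 1 by omega, show i ≠ 0 by omega]
      ring

theorem exists_tan_eq_of_abs_sub_lt (m : ℕ) (t : ℝ) :
    ∃ x : ℝ, |x - m * Real.pi| < Real.pi / 2 ∧ Real.tan x = t := by
  refine ⟨Real.arctan t + m * Real.pi, ?_, ?_⟩
  · rw [add_sub_cancel_right, abs_lt]
    exact ⟨Real.neg_pi_div_two_lt_arctan t, Real.arctan_lt_pi_div_two t⟩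
  · rw [Real.tan_add_nat_mul_pi, Real.tan_arctan]

theorem eq_of_tan_eq_of_abs_sub_lt {m : ℕ} {x y : ℝ} (hx : |x - m * Real.pi| < Real.pi / 2)
    (hy : |y - m * Real.pi| < Real.pi / 2) (hxy : Real.tan x = Real.tan y) : x = y := by
  rw [← Real.tan_sub_nat_mul_pi x m, ← Real.tan_sub_nat_mul_pi y m] at hxy
  exact sub_left_injective (Real.injOn_tan (abs_lt.1 hx) (abs_lt.1 hy) hxy)

theorem cos_ne_zero_of_abs_sub_lt {m : ℕ} {x : ℝ} (hx : |x - m * Real.pi| < Real.pi / 2) :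
    Real.cos x ≠ 0 := by
  have h := (Real.cos_pos_of_mem_Ioo (abs_lt.1 hx)).ne'
  rw [Real.cos_sub_nat_mul_pi] at h
  exact right_ne_zero_of_mul h

end

/-- On each connected component
`O_μ = { y : |y_i − μ_{i−1}π| < π/2, i = 2, …, n }`, `μ ∈ {0,1}^{n-1}`, the map
`S = (L_{h₁}^0 y₁, …, L_{h₁}^{n-1} y₁)` of the truck with multiple trailers is a
bijection onto `ℝⁿ`. -/
theorem stmt16 {n : ℕ} (hn : 2 ≤ n)
    (l : ℕ → ℝ) (hl : ∀ i, 1 ≤ i → i ≤ n - 1 → 0 < l i)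
    (h₁ : EuclideanSpace ℝ (Fin n) → EuclideanSpace ℝ (Fin n))
    (hh₁ : ∀ y (j : Fin n), h₁ y j = if (j : ℕ) < n - 1 then etaFun l ((j : ℕ) + 1) y else 0)
    (y₁ : EuclideanSpace ℝ (Fin n) → ℝ) (hy₁ : ∀ y, y₁ y = y ⟨0, by omega⟩)
    (S : EuclideanSpace ℝ (Fin n) → EuclideanSpace ℝ (Fin n))
    (hS : ∀ y (i : Fin n), S y i = lieIter h₁ y₁ i y)
    (μ : ℕ → ℕ) (hμ : ∀ i, μ i = 0 ∨ μ i = 1)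
    (Oμ : Set (EuclideanSpace ℝ (Fin n)))
    (hOμ : Oμ = { y | ∀ i, 2 ≤ i → i ≤ n →
      |coord y i - (μ (i - 1) : ℝ) * Real.pi| < Real.pi / 2 }) :
    Set.BijOn S Oμ Set.univ := by
  have hO : ∀ y, y ∈ Oμ ↔ ∀ j : Fin n, 1 ≤ (j : ℕ) →
      |y j - (μ j : ℝ) * Real.pi| < Real.pi / 2 := by
    intro y
    rw [hOμ]
    refine ⟨fun h j hj => ?_, fun h i hi hin => ?_⟩
    · simpa [coord_succ] using h (j + 1) (by omega) (by omega)
    · have := h ⟨i - 1, by omega⟩ (by simp; omega)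
      simpa [coord, show i - 1 < n by omega] using this
  have hreg : ∀ y ∈ Oμ, y ∈ regularSet n := by
    intro y hy k hk
    rw [hOμ] at hy
    rw [Finset.mem_Icc] at hk
    exact cos_ne_zero_of_abs_sub_lt (hy k hk.1 hk.2)
  have hS0 : ∀ y (i : Fin n), (i : ℕ) = 0 → S y i = y i := by
    intro y i hi
    have hi0 : i = ⟨0, by omega⟩ := Fin.ext hi
    rw [hS, hi0]
    exact hy₁ y
  have hφ : ∀ y, y₁ y = coord y 1 := fun y => by
    rw [hy₁, ← coord_succ]
  have htri : ∀ i : Fin n, 1 ≤ (i : ℕ) → ∃ θ ξ : EuclideanSpace ℝ (Fin n) → ℝ,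
      SmoothInFirst i θ ∧ SmoothInFirst i ξ ∧ (∀ y ∈ regularSet n, θ y ≠ 0) ∧
      ∀ y ∈ regularSet n, S y i = θ y * Real.tan (y i) + ξ y := by
    intro i hi
    simpa only [hS, coord_succ] using exists_lieIter_eq hl hh₁ hφ hi i.2
  refine ⟨fun _ _ => mem_univ _, fun y hy y' hy' heq => ?_, fun z _ => ?_⟩
  · have key : ∀ k : ℕ, ∀ j : Fin n, (j : ℕ) < k → y j = y' j := by
      intro k
      induction k with
      | zero => intro j hj; omega
      | succ k ih =>
        intro j hj
        have hlt : ∀ j' : Fin n, (j' : ℕ) < j → y j' = y' j' := fun j' hj' => ih j' (by omega)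
        have hSj : S y j = S y' j := by rw [heq]
        rcases Nat.eq_zero_or_pos (j : ℕ) with h0 | h1
        · rwa [hS0 _ _ h0, hS0 _ _ h0] at hSj
        · obtain ⟨θ, ξ, hθ, hξ, hθ0, hSeq⟩ := htri j h1
          rw [hSeq y (hreg y hy), hSeq y' (hreg y' hy'),
            hθ.congr_truncate (hreg y hy) (hreg y' hy') hlt,
            hξ.congr_truncate (hreg y hy) (hreg y' hy') hlt] at hSj
          exact eq_of_tan_eq_of_abs_sub_lt ((hO y).1 hy j h1) ((hO y').1 hy' j h1)
            (mul_left_cancel₀ (hθ0 y' (hreg y' hy')) (add_right_cancel hSj))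
    ext j
    exact key n j j.2
  · have key : ∀ k : ℕ, ∃ y ∈ Oμ, ∀ j : Fin n, (j : ℕ) < k → S y j = z j := by
      intro k
      induction k with
      | zero =>
        refine ⟨WithLp.toLp 2 fun j => (μ j : ℝ) * Real.pi, (hO _).2 fun j _ => ?_, ?_⟩
        · simp [Real.pi_pos]
        · intro j hj; omega
      | succ k ih =>
        obtain ⟨y, hy, hyz⟩ := ih
        by_cases hk : k < n
        swap
        · exact ⟨y, hy, fun j _ => hyz j (by omega)⟩
        have hex : ∃ x : ℝ, (1 ≤ k → |x - (μ k : ℝ) * Real.pi| < Real.pi / 2) ∧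
            ∀ y' ∈ Oμ, (∀ j : Fin n, (j : ℕ) < k → y' j = y j) → y' ⟨k, hk⟩ = x →
              S y' ⟨k, hk⟩ = z ⟨k, hk⟩ := by
          rcases Nat.eq_zero_or_pos k with h0 | h1
          · exact ⟨z ⟨k, hk⟩, fun h => by omega, fun y' _ _ hx => by rw [hS0 _ _ h0, hx]⟩
          · obtain ⟨θ, ξ, hθ, hξ, hθ0, hSeq⟩ := htri ⟨k, hk⟩ h1
            obtain ⟨x, hx, hxt⟩ := exists_tan_eq_of_abs_sub_lt (μ k) ((z ⟨k, hk⟩ - ξ y) / θ y)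
            refine ⟨x, fun _ => hx, fun y' hy' hlt hxy => ?_⟩
            rw [hSeq y' (hreg y' hy'), hxy, hxt,
              hθ.congr_truncate (hreg y' hy') (hreg y hy) hlt,
              hξ.congr_truncate (hreg y' hy') (hreg y hy) hlt,
              mul_div_cancel₀ _ (hθ0 y (hreg y hy)), sub_add_cancel]
        obtain ⟨x, hx, hxS⟩ := hex
        let y' : EuclideanSpace ℝ (Fin n) :=
          WithLp.toLp 2 fun j => if (j : ℕ) = k then x else y j
        have hy'k : ∀ j : Fin n, (j : ℕ) = k → y' j = x := fun j hj => if_pos hj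
        have hy'ne : ∀ j : Fin n, (j : ℕ) ≠ k → y' j = y j := fun j hj => if_neg hj
        have hy' : y' ∈ Oμ := by
          refine (hO y').2 fun j hj => ?_
          by_cases hjk : (j : ℕ) = k
          · rw [hy'k j hjk, hjk]
            exact hx (by omega)
          · rw [hy'ne j hjk]
            exact (hO y).1 hy j hj
        refine ⟨y', hy', fun j hj => ?_⟩
        by_cases hjk : (j : ℕ) = k
        · obtain rfl : j = ⟨k, hk⟩ := Fin.ext hjk
          exact hxS y' hy' (fun i hi => hy'ne i (Nat.ne_of_lt hi)) (hy'k _ rfl)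
        · rw [← hyz j (by omega)]
          rcases Nat.eq_zero_or_pos (j : ℕ) with h0 | h1
          · rw [hS0 _ _ h0, hS0 _ _ h0, hy'ne j hjk]
          · obtain ⟨θ, ξ, hθ, hξ, -, hSeq⟩ := htri j h1
            have hlt : ∀ i : Fin n, (i : ℕ) < j → y' i = y i :=
              fun i hi => hy'ne i (by omega)
            rw [hSeq y' (hreg y' hy'), hSeq y (hreg y hy), hy'ne j hjk,
              hθ.congr_truncate (hreg y' hy') (hreg y hy) hlt,
              hξ.congr_truncate (hreg y' hy') (hreg y hy) hlt]
    obtain ⟨y, hy, hyz⟩ := key n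
    exact ⟨y, hy, by ext j; exact hyz j j.2⟩
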